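/- In any group G, if g is a right Engel element then g⁻¹ is a left Engel element; i.e., R(G)⁻¹ ⊆ L(G). -/

import Mathlib

/-- Iterated (Engel) commutator: `engel x g n` is `[x,ₙ g]`, with `engel x g 0 = x`. -/
def engel {G : Type*} [Group G] (x g : G) : ℕ → G
  | 0 => x
  | n + 1 => (engel x g n)⁻¹ * g⁻¹ * engel x g n * g

/-- Iterated commutators of `x` with `g⁻¹` are conjugate to iterated commutators of `g` with
the conjugate `x * g⁻¹ * x⁻¹`. -/
theorem engel_inv_eq_conj {G : Type*} [Group G] (x g : G) (n : ℕ) :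
    engel x g⁻¹ (n + 2) =
      (x * g⁻¹)⁻¹ * engel g (x * g⁻¹ * x⁻¹) (n + 1) * (x * g⁻¹) := by
  induction n with
  | zero => simp only [engel]; group
  | succ n ih =>
    rw [engel, ih, engel.eq_2 g _ (n + 1)]
    group

/-- In any group `G`, the inverse of a right Engel element is a left Engel
element: `R(G)⁻¹ ⊆ L(G)`. -/
theorem right_engel_inv_mem_left_engel {G : Type*} [Group G] (g : G)
    (hg : ∀ x : G, ∃ n : ℕ, 1 ≤ n ∧ engel g x n = 1) :
    ∀ x : G, ∃ n : ℕ, 1 ≤ n ∧ engel x g⁻¹ n = 1 := by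
  intro x
  obtain ⟨n, hn, h⟩ := hg (x * g⁻¹ * x⁻¹)
  obtain ⟨m, rfl⟩ := Nat.exists_eq_add_of_le' hn
  exact ⟨m + 2, by omega, by rw [engel_inv_eq_conj, h]; group⟩
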